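/- arXiv:math/0202164 — 4 statements merged into one kernel-verified Lean document; each statement's English description precedes it below -/
import Mathlib

section
/- Let H be a finite-dimensional associative unital ℂ-algebra equipped with a symmetric invariant bilinear form (·,·) (i.e. (x,y) = (y,x) and (xy,z) = (x,yz) for all x,y,z ∈ H). Let A ⊆ H be a unital subalgebra contained in the center of H whose unit equals the unit of H, let B ⊆ H be a two-sided ideal, suppose H = A ⊕ B as vector spaces, and suppose the restriction of (·,·) to B is nondegenerate. Let φ : A → B be the unique linear map satisfying (φ(a), b) = (a, b) for all a ∈ A and b ∈ B. Then φ is an algebra homomorphism (φ(a a') = φ(a) φ(a') for all a, a' ∈ A), the image of φ lies in the center of B (φ(a) b = b φ(a) for all a ∈ A, b ∈ B), and a b = φ(a) b for every a ∈ A and b ∈ B. -/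
/-- Let `H` be a finite-dimensional associative unital ℂ-algebra with a symmetric
invariant bilinear form, `A` a unital subalgebra contained in the center (sharing the
unit of `H`), `B` a two-sided ideal, `H = A ⊕ B` as vector spaces, with the form
nondegenerate on `B`.  Let `φ` be the (unique) linear map satisfying
`(φ a, b) = (a, b)` for `a ∈ A`, `b ∈ B`, taking values in `B`.  Then `φ` is
multiplicative on `A`, its image is central in `B`, and `a * b = φ a * b` for
`a ∈ A`, `b ∈ B`. -/
theorem structure_algebra_phi_hom
    (H : Type*) [Ring H] [Algebra ℂ H] [FiniteDimensional ℂ H]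
    (form : H →ₗ[ℂ] H →ₗ[ℂ] ℂ)
    (hsymm : ∀ x y : H, form x y = form y x)
    (hinv : ∀ x y z : H, form (x * y) z = form x (y * z))
    (A : Subalgebra ℂ H) (hA : A ≤ Subalgebra.center ℂ H)
    (B : Submodule ℂ H)
    (hBl : ∀ x : H, ∀ b ∈ B, x * b ∈ B)
    (hBr : ∀ x : H, ∀ b ∈ B, b * x ∈ B)
    (hcompl : IsCompl (Subalgebra.toSubmodule A) B)
    (hnd : ∀ b ∈ B, (∀ b' ∈ B, form b b' = 0) → b = 0)
    (φ : H →ₗ[ℂ] H)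
    (hφmem : ∀ a ∈ A, φ a ∈ B)
    (hφdef : ∀ a ∈ A, ∀ b ∈ B, form (φ a) b = form a b) :
    (∀ a ∈ A, ∀ a' ∈ A, φ (a * a') = φ a * φ a') ∧
    (∀ a ∈ A, ∀ b ∈ B, φ a * b = b * φ a) ∧
    (∀ a ∈ A, ∀ b ∈ B, a * b = φ a * b) := by
  have eq_of_form : ∀ x ∈ B, ∀ y ∈ B, (∀ b ∈ B, form x b = form y b) → x = y := by
    intro x hx y hy h
    refine sub_eq_zero.mp (hnd _ (B.sub_mem hx hy) fun b hb => ?_)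
    rw [map_sub, LinearMap.sub_apply, h b hb, sub_self]
  have mul_eq : ∀ a ∈ A, ∀ b ∈ B, a * b = φ a * b := by
    intro a ha b hb
    refine eq_of_form _ (hBl _ b hb) _ (hBl _ b hb) fun c hc => ?_
    rw [hinv, hinv, hφdef a ha _ (hBl b c hc)]
  have mul_eq' : ∀ a ∈ A, ∀ b ∈ B, b * a = b * φ a := by
    intro a ha b hb
    refine eq_of_form _ (hBr _ b hb) _ (hBr _ b hb) fun c hc => ?_
    rw [hinv, hinv, mul_eq a ha c hc]
  refine ⟨fun a ha a' ha' => ?_, fun a ha b hb => ?_, mul_eq⟩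
  · refine eq_of_form _ (hφmem _ (A.mul_mem ha ha')) _ (hBl _ _ (hφmem a' ha')) fun b hb => ?_
    rw [hφdef _ (A.mul_mem ha ha') b hb, hinv, hinv, ← mul_eq a' ha' b hb,
      hφdef a ha _ (hBl a' b hb)]
  · rw [← mul_eq a ha b hb, ← mul_eq' a ha b hb]
    exact (Subalgebra.mem_center_iff.mp (hA ha) b).symm
end

section
/- Let M be a nonempty finite set and let s₁, s₂ be permutations of M with s₁² = id and s₂² = id such that the subgroup generated by s₁ and s₂ acts transitively on M. Then: (a) s₁ has at most two fixed points and s₂ has at most two fixed points; (b) the total number of fixed points of s₁ plus the number of fixed points of s₂ is either 0 or 2; and (c) the cardinality of M is odd if and only if s₁ has exactly one fixed point and s₂ has exactly one fixed point. -/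
open Equiv

/-- The graph joining every point to its distinct images under two involutions. -/
def involutionPairGraph {M : Type*} (s t : Perm M) (hs : s ^ 2 = 1) (ht : t ^ 2 = 1) :
    SimpleGraph M where
  Adj x y := x ≠ y ∧ (s x = y ∨ t x = y)
  symm := ⟨by
    have hs' (x : M) : s (s x) = x := by simpa [sq] using congrArg (· x) hs
    have ht' (x : M) : t (t x) = x := by simpa [sq] using congrArg (· x) ht
    rintro x y ⟨hne, rfl | rfl⟩
    · exact ⟨hne.symm, .inl (hs' x)⟩
    · exact ⟨hne.symm, .inr (ht' x)⟩⟩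
  loopless := ⟨fun _ h => h.1 rfl⟩

theorem involutionPairGraph_connected {M : Type*} [Nonempty M] (s t : Perm M)
    (hs : s ^ 2 = 1) (ht : t ^ 2 = 1)
    (htrans : ∀ x y : M, ∃ g ∈ Subgroup.closure ({s, t} : Set (Perm M)), g x = y) :
    (involutionPairGraph s t hs ht).Connected := by
  have key : ∀ g ∈ Subgroup.closure ({s, t} : Set (Perm M)), ∀ x,
      (involutionPairGraph s t hs ht).Reachable x (g x) := by
    intro g hg
    induction hg using Subgroup.closure_induction with
    | mem g hg =>
      intro x
      by_cases hx : x = g x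
      · rw [← hx]
      · refine SimpleGraph.Adj.reachable ⟨hx, ?_⟩
        rcases hg with rfl | rfl
        · exact .inl rfl
        · exact .inr rfl
    | one => exact fun x => .refl x
    | mul g h _ _ ihg ihh => exact fun x => (ihh x).trans (ihg (h x))
    | inv g _ ih => exact fun x => by simpa using (ih (g⁻¹ x)).symm
  refine ⟨fun x y => ?_⟩
  obtain ⟨g, hg, rfl⟩ := htrans x y
  exact key g hg x

theorem card_fixed_add_card_fixed_le_two {M : Type*} [Fintype M] [Nonempty M] [DecidableEq M]
    (s t : Perm M) (hs : s ^ 2 = 1) (ht : t ^ 2 = 1)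
    (htrans : ∀ x y : M, ∃ g ∈ Subgroup.closure ({s, t} : Set (Perm M)), g x = y) :
    (Finset.univ.filter fun x : M => s x = x).card +
      (Finset.univ.filter fun x : M => t x = x).card ≤ 2 := by
  classical
  have hcard := (involutionPairGraph_connected s t hs ht htrans).card_vert_le_card_edgeSet_add_one
  have hsum := (involutionPairGraph s t hs ht).sum_degrees_eq_twice_card_edges
  have hdeg (x : M) : (involutionPairGraph s t hs ht).degree x +
      ((if s x = x then 1 else 0) + (if t x = x then 1 else 0)) ≤ 2 := by
    have hsub : (involutionPairGraph s t hs ht).neighborFinset x ⊆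
        ({s x, t x} : Finset M).erase x := by
      intro y hy
      rw [SimpleGraph.mem_neighborFinset] at hy
      obtain ⟨hne, h⟩ := hy
      simp only [Finset.mem_erase, Finset.mem_insert, Finset.mem_singleton]
      exact ⟨hne.symm, h.imp Eq.symm Eq.symm⟩
    have hle := Finset.card_le_card hsub
    rw [SimpleGraph.card_neighborFinset_eq_degree] at hle
    have h2 : ({s x, t x} : Finset M).card ≤ 2 := Finset.card_le_two
    split_ifs with h h' h'
    · simp [h, h'] at hle
      omega
    · rw [h, Finset.erase_insert (by simpa using Ne.symm h')] at hle
      simp at hle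
      omega
    · rw [h', Finset.pair_comm, Finset.erase_insert (by simpa using Ne.symm h)] at hle
      simp at hle
      omega
    · exact hle.trans ((Finset.card_erase_le).trans h2)
  have htotal := Finset.sum_le_sum fun x (_ : x ∈ Finset.univ) => hdeg x
  simp only [Finset.sum_add_distrib, hsum, Finset.sum_const, Finset.card_univ, smul_eq_mul,
    ← Finset.card_filter] at htotal
  rw [Nat.card_eq_fintype_card, Nat.card_eq_fintype_card, ← SimpleGraph.edgeFinset_card] at hcard
  omega

theorem card_mod_two_eq_card_fixed_mod_two {M : Type*} [Fintype M] [DecidableEq M]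
    (s : Perm M) (hs : s ^ 2 = 1) :
    Fintype.card M % 2 = (Finset.univ.filter fun x : M => s x = x).card % 2 := by
  have h := Perm.card_compl_support_modEq (p := 2) (n := 1) (σ := s) (by simpa using hs)
  have hfix : s.supportᶜ = Finset.univ.filter fun x : M => s x = x := by
    ext x
    simp
  rw [hfix] at h
  exact h.symm

/-- For a transitive pair of involutions `s₁, s₂` on a nonempty finite set `M`:
each has at most two fixed points, the total number of fixed points is `0` or `2`,
and `|M|` is odd iff each of `s₁, s₂` has exactly one fixed point. -/
theorem transitive_involution_pair_fixed_points
    (M : Type*) [Fintype M] [Nonempty M] [DecidableEq M]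
    (s₁ s₂ : Equiv.Perm M) (h₁ : s₁ ^ 2 = 1) (h₂ : s₂ ^ 2 = 1)
    (htrans : ∀ x y : M,
      ∃ g ∈ Subgroup.closure ({s₁, s₂} : Set (Equiv.Perm M)), g x = y) :
    ((Finset.univ.filter fun x : M => s₁ x = x).card ≤ 2 ∧
      (Finset.univ.filter fun x : M => s₂ x = x).card ≤ 2) ∧
    ((Finset.univ.filter fun x : M => s₁ x = x).card +
        (Finset.univ.filter fun x : M => s₂ x = x).card = 0 ∨
      (Finset.univ.filter fun x : M => s₁ x = x).card +
        (Finset.univ.filter fun x : M => s₂ x = x).card = 2) ∧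
    (Odd (Fintype.card M) ↔
      ((Finset.univ.filter fun x : M => s₁ x = x).card = 1 ∧
        (Finset.univ.filter fun x : M => s₂ x = x).card = 1)) := by
  have hle := card_fixed_add_card_fixed_le_two s₁ s₂ h₁ h₂ htrans
  have hp₁ := card_mod_two_eq_card_fixed_mod_two s₁ h₁
  have hp₂ := card_mod_two_eq_card_fixed_mod_two s₂ h₂
  rw [Nat.odd_iff]
  omega
end

section
/- Let M and M' be nonempty finite sets, let s₁, s₂ be involutive permutations of M whose generated subgroup acts transitively on M, and let s₁', s₂' be involutive permutations of M' whose generated subgroup acts transitively on M'. If |M| = |M'|, the number of fixed points of s₁ equals the number of fixed points of s₁', and the number of fixed points of s₂ equals the number of fixed points of s₂', then there exists a bijection φ : M → M' such that φ ∘ s₁ = s₁' ∘ φ and φ ∘ s₂ = s₂' ∘ φ. -/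
namespace InvolutionPair

variable {M M' : Type*}

/-- The alternating orbit `x, a x, b (a x), a (b (a x)), …` of a pair of permutations. -/
def walk (a b : Equiv.Perm M) (x : M) : ℕ → M
  | 0 => x
  | k + 1 => if Even k then a (walk a b x k) else b (walk a b x k)

/-- The action of the first involution on positions along the walk. -/
def fstIndex (n k : ℕ) : ℕ :=
  if Even k then (if k + 1 < n then k + 1 else k) else k - 1

/-- The action of the second involution on positions along a path starting at one of its
fixed points. -/
def sndIndexPath (n k : ℕ) : ℕ :=
  if Even k then k - 1 else (if k + 1 < n then k + 1 else k)

/-- The action of the second involution on positions along a cycle of length `n`. -/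
def sndIndexCycle (n k : ℕ) : ℕ :=
  if Even k then (if k = 0 then n - 1 else k - 1) else (if k + 1 < n then k + 1 else 0)

theorem walk_succ_of_even {a b : Equiv.Perm M} {x : M} {k : ℕ} (hk : Even k) :
    walk a b x (k + 1) = a (walk a b x k) := by
  simp [walk, hk]

theorem walk_succ_of_odd {a b : Equiv.Perm M} {x : M} {k : ℕ} (hk : ¬ Even k) :
    walk a b x (k + 1) = b (walk a b x k) := by
  simp [walk, hk]

theorem fst_walk_of_odd {a b : Equiv.Perm M} (ha : ∀ y, a (a y) = y) {x : M} {k : ℕ}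
    (hk : ¬ Even k) : a (walk a b x k) = walk a b x (k - 1) := by
  obtain _ | k := k
  · simp at hk
  · rw [walk_succ_of_even (by grind), ha, Nat.add_sub_cancel]

theorem snd_walk_of_even {a b : Equiv.Perm M} (hb : ∀ y, b (b y) = y) {x : M} {k : ℕ}
    (hk : Even k) (hk₀ : k ≠ 0) : b (walk a b x k) = walk a b x (k - 1) := by
  obtain _ | k := k
  · simp at hk₀
  · rw [walk_succ_of_odd (by grind), hb, Nat.add_sub_cancel]

/-- A nonempty set stable under a transitive pair of involutions is everything. -/
theorem mem_of_stable {a b : Equiv.Perm M} (ha : ∀ y, a (a y) = y) (hb : ∀ y, b (b y) = y)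
    (htrans : ∀ x y : M, ∃ g ∈ Subgroup.closure ({a, b} : Set (Equiv.Perm M)), g x = y)
    {S : Set M} (hSa : ∀ y ∈ S, a y ∈ S) (hSb : ∀ y ∈ S, b y ∈ S) {x : M} (hx : x ∈ S)
    (y : M) : y ∈ S := by
  obtain ⟨g, hg, rfl⟩ := htrans x y
  suffices h : ∀ z, z ∈ S ↔ g z ∈ S from (h x).1 hx
  clear hx
  induction hg using Subgroup.closure_induction with
  | mem g hg =>
    rcases hg with rfl | rfl
    · exact fun z => ⟨hSa z, fun h => ha z ▸ hSa _ h⟩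
    · exact fun z => ⟨hSb z, fun h => hb z ▸ hSb _ h⟩
  | one => simp
  | mul g h _ _ hg hh => exact fun z => (hh z).trans (hg _)
  | inv g _ hg => exact fun z => by simpa using (hg (g⁻¹ z)).symm

section Walk

variable {a b : Equiv.Perm M} (ha : ∀ y, a (a y) = y) (hb : ∀ y, b (b y) = y)
  (htrans : ∀ x y : M, ∃ g ∈ Subgroup.closure ({a, b} : Set (Equiv.Perm M)), g x = y)
  {x : M}

include ha hb htrans

/-- If the walk revisits its initial segment, which also contains the image of the starting
point under the second involution, then that segment is everything. -/
theorem exists_walk_eq {m : ℕ} (hm : ∃ j ≤ m, walk a b x (m + 1) = walk a b x j)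
    (h₀ : ∃ j ≤ m, b x = walk a b x j) (y : M) : ∃ k ≤ m, walk a b x k = y := by
  have hstep : ∀ k ≤ m, ∃ j ≤ m, walk a b x j = walk a b x (k + 1) := by
    intro k hk
    rcases hk.lt_or_eq with h | rfl
    · exact ⟨k + 1, h, rfl⟩
    · exact hm.imp fun j hj => ⟨hj.1, hj.2.symm⟩
  refine mem_of_stable ha hb htrans (S := {y | ∃ k ≤ m, walk a b x k = y}) ?_ ?_
    ⟨0, m.zero_le, rfl⟩ y
  · rintro _ ⟨k, hk, rfl⟩
    by_cases he : Even k
    · exact walk_succ_of_even he ▸ hstep k hk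
    · exact ⟨k - 1, by omega, (fst_walk_of_odd ha he).symm⟩
  · rintro _ ⟨k, hk, rfl⟩
    by_cases he : Even k
    · obtain rfl | h := eq_or_ne k 0
      · exact h₀.imp fun j hj => ⟨hj.1, hj.2.symm⟩
      · exact ⟨k - 1, by omega, (snd_walk_of_even hb he h).symm⟩
    · exact walk_succ_of_odd he ▸ hstep k hk

variable [Fintype M]

/-- The walk is injective on `{0, …, |M| - 1}` provided every first return to the initial segment
forces that segment to contain the image of the starting point under the second involution. -/
theorem injOn_walk (h₀ : ∀ m, Set.InjOn (walk a b x) (Set.Iic m) →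
      (∃ j ≤ m, walk a b x (m + 1) = walk a b x j) → ∃ j ≤ m, b x = walk a b x j) :
    Set.InjOn (walk a b x) (Set.Iio (Fintype.card M)) := by
  classical
  have key : ∀ m < Fintype.card M, Set.InjOn (walk a b x) (Set.Iic m) := by
    intro m
    induction m with
    | zero => intro _ i hi j hj _; simp_all
    | succ m ih =>
      intro hm
      have hinj := ih (by omega)
      have hnot : ¬ ∃ j ≤ m, walk a b x (m + 1) = walk a b x j := by
        intro hret
        have hsurj := exists_walk_eq ha hb htrans hret (h₀ m hinj hret)
        have hle : Fintype.card M ≤ ((Finset.range (m + 1)).image (walk a b x)).card := by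
          rw [← Finset.card_univ]
          refine Finset.card_le_card fun y _ => ?_
          obtain ⟨k, hk, rfl⟩ := hsurj y
          exact Finset.mem_image_of_mem _ (Finset.mem_range.2 (by omega))
        have := Finset.card_image_le (s := Finset.range (m + 1)) (f := walk a b x)
        rw [Finset.card_range] at this
        omega
      push Not at hnot
      intro i hi j hj hij
      rw [Set.mem_Iic] at hi hj
      rcases hi.lt_or_eq with hi | rfl <;> rcases hj.lt_or_eq with hj | rfl
      · exact hinj (Nat.lt_succ_iff.1 hi) (Nat.lt_succ_iff.1 hj) hij
      · exact absurd hij.symm (hnot i (by omega))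
      · exact absurd hij (hnot j (by omega))
      · rfl
  intro i hi j hj hij
  exact key (max i j) (max_lt hi hj) (le_max_left i j) (le_max_right i j) hij

omit ha hb htrans in
theorem exists_walk_eq_of_injOn
    (hinj : Set.InjOn (walk a b x) (Set.Iio (Fintype.card M))) (y : M) :
    ∃ k < Fintype.card M, walk a b x k = y := by
  classical
  have h : (Finset.range (Fintype.card M)).image (walk a b x) = Finset.univ := by
    rw [← Finset.card_eq_iff_eq_univ, Finset.card_image_of_injOn (by simpa using hinj),
      Finset.card_range]
  have hy := Finset.mem_univ y
  rw [← h] at hy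
  simpa using hy

theorem injOn_walk_path (hx : b x = x) :
    Set.InjOn (walk a b x) (Set.Iio (Fintype.card M)) :=
  injOn_walk ha hb htrans fun m _ _ => ⟨0, m.zero_le, hx⟩

theorem injOn_walk_cycle (hfa : ∀ y, a y ≠ y) (hfb : ∀ y, b y ≠ y) :
    Set.InjOn (walk a b x) (Set.Iio (Fintype.card M)) := by
  refine injOn_walk ha hb htrans fun m hinj ⟨j, hj, hret⟩ => ?_
  have inj : ∀ i ≤ m, ∀ k ≤ m, walk a b x i = walk a b x k → i = k :=
    fun i hi k hk h => hinj hi hk h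
  have hjm : j ≠ m := by
    rintro rfl
    by_cases he : Even j
    · exact hfa _ (walk_succ_of_even he ▸ hret)
    · exact hfb _ (walk_succ_of_odd he ▸ hret)
  by_cases he : Even m
  · rw [walk_succ_of_even he] at hret
    have hret' : walk a b x m = a (walk a b x j) := by rw [← hret, ha]
    by_cases hje : Even j
    · rw [← walk_succ_of_even hje] at hret'
      have := inj _ le_rfl _ (by omega) hret'
      grind
    · rw [fst_walk_of_odd ha hje] at hret'
      have := inj _ le_rfl _ (by omega) hret'
      grind
  · rw [walk_succ_of_odd he] at hret
    have hret' : walk a b x m = b (walk a b x j) := by rw [← hret, hb]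
    by_cases hje : Even j
    · obtain rfl | hj₀ := eq_or_ne j 0
      · exact ⟨m, le_rfl, hret'.symm⟩
      · rw [snd_walk_of_even hb hje hj₀] at hret'
        have := inj _ le_rfl _ (by omega) hret'
        grind
    · rw [← walk_succ_of_odd hje] at hret'
      have := inj _ le_rfl _ (by omega) hret'
      grind

omit hb htrans in
/-- If the walk has even last position, its last point is fixed by the first involution. -/
theorem fst_walk_last (hinj : Set.InjOn (walk a b x) (Set.Iio (Fintype.card M))) {k : ℕ}
    (hk : k + 1 = Fintype.card M) (he : Even k) : a (walk a b x k) = walk a b x k := by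
  obtain ⟨j, hj, hjk⟩ := exists_walk_eq_of_injOn hinj (a (walk a b x k))
  have hret : walk a b x k = a (walk a b x j) := by rw [hjk, ha]
  obtain rfl | hne := eq_or_ne j k
  · exact hret.symm
  by_cases hje : Even j
  · rw [← walk_succ_of_even hje] at hret
    have := hinj (Set.mem_Iio.2 (by omega)) (Set.mem_Iio.2 (by omega)) hret
    grind
  · rw [fst_walk_of_odd ha hje] at hret
    have := hinj (Set.mem_Iio.2 (by omega)) (Set.mem_Iio.2 (by omega)) hret
    omega

omit ha htrans in
/-- If the walk has odd last position, the second involution fixes its last point or sends it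
to the starting point. -/
theorem snd_walk_last (hinj : Set.InjOn (walk a b x) (Set.Iio (Fintype.card M))) {k : ℕ}
    (hk : k + 1 = Fintype.card M) (he : ¬ Even k) :
    b (walk a b x k) = walk a b x k ∨ b (walk a b x k) = x := by
  obtain ⟨j, hj, hjk⟩ := exists_walk_eq_of_injOn hinj (b (walk a b x k))
  have hret : walk a b x k = b (walk a b x j) := by rw [hjk, hb]
  obtain rfl | hne := eq_or_ne j k
  · exact Or.inl hret.symm
  obtain rfl | hj₀ := eq_or_ne j 0
  · exact Or.inr hjk.symm
  by_cases hje : Even j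
  · rw [snd_walk_of_even hb hje hj₀] at hret
    have := hinj (Set.mem_Iio.2 (by omega)) (Set.mem_Iio.2 (by omega)) hret
    omega
  · rw [← walk_succ_of_odd hje] at hret
    have := hinj (Set.mem_Iio.2 (by omega)) (Set.mem_Iio.2 (by omega)) hret
    grind

omit hb htrans in
theorem fst_walk (hinj : Set.InjOn (walk a b x) (Set.Iio (Fintype.card M))) {k : ℕ}
    (hk : k < Fintype.card M) :
    a (walk a b x k) = walk a b x (fstIndex (Fintype.card M) k) := by
  unfold fstIndex
  split_ifs with he hlt
  · exact (walk_succ_of_even he).symm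
  · exact fst_walk_last ha hinj (by omega) he
  · exact fst_walk_of_odd ha he

omit ha htrans in
theorem snd_walk_path (hinj : Set.InjOn (walk a b x) (Set.Iio (Fintype.card M)))
    (hx : b x = x) {k : ℕ} (hk : k < Fintype.card M) :
    b (walk a b x k) = walk a b x (sndIndexPath (Fintype.card M) k) := by
  unfold sndIndexPath
  split_ifs with he hlt
  · obtain rfl | hk₀ := eq_or_ne k 0
    · exact hx
    · exact snd_walk_of_even hb he hk₀
  · exact (walk_succ_of_odd he).symm
  · refine (snd_walk_last hb hinj (by omega) he).elim id fun h => ?_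
    have hkx : walk a b x k = walk a b x 0 := b.injective (h.trans hx.symm)
    rw [h, hkx]
    rfl

omit htrans in
theorem snd_walk_cycle (hinj : Set.InjOn (walk a b x) (Set.Iio (Fintype.card M)))
    (hfa : ∀ y, a y ≠ y) (hfb : ∀ y, b y ≠ y) {k : ℕ} (hk : k < Fintype.card M) :
    b (walk a b x k) = walk a b x (sndIndexCycle (Fintype.card M) k) := by
  have hlast : ∀ m, m + 1 = Fintype.card M → b (walk a b x m) = x := fun m hm =>
    (snd_walk_last hb hinj hm fun he => hfa _ (fst_walk_last ha hinj hm he)).resolve_left (hfb _)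
  unfold sndIndexCycle
  split_ifs with he hk₀ hlt
  · subst hk₀
    exact b.injective ((hb x).trans (hlast _ (by omega)).symm)
  · exact snd_walk_of_even hb he hk₀
  · exact (walk_succ_of_odd he).symm
  · exact hlast k (by omega)

end Walk

/-- Two pairs of permutations admitting enumerations on which they act by the same index maps
are equivalent. -/
theorem exists_equiv_of_enumeration [Fintype M] [Fintype M']
    (hcard : Fintype.card M = Fintype.card M') {a b : Equiv.Perm M} {a' b' : Equiv.Perm M'}
    {w : ℕ → M} {w' : ℕ → M'} {A B : ℕ → ℕ}
    (hw : Set.InjOn w (Set.Iio (Fintype.card M)))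
    (hsurj : ∀ y, ∃ k < Fintype.card M, w k = y)
    (hw' : Set.InjOn w' (Set.Iio (Fintype.card M')))
    (hA : ∀ k < Fintype.card M, A k < Fintype.card M)
    (hB : ∀ k < Fintype.card M, B k < Fintype.card M)
    (ha : ∀ k < Fintype.card M, a (w k) = w (A k))
    (hb : ∀ k < Fintype.card M, b (w k) = w (B k))
    (ha' : ∀ k < Fintype.card M', a' (w' k) = w' (A k))
    (hb' : ∀ k < Fintype.card M', b' (w' k) = w' (B k)) :
    ∃ φ : M ≃ M', (∀ x, φ (a x) = a' (φ x)) ∧ ∀ x, φ (b x) = b' (φ x) := by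
  choose p hp hwp using hsurj
  have hpw : ∀ k < Fintype.card M, p (w k) = k := fun k hk => hw (hp _) hk (hwp _)
  have hinj : Function.Injective fun x => w' (p x) := fun x y h => by
    rw [← hwp x, ← hwp y, hw' (hcard ▸ hp x) (hcard ▸ hp y) h]
  refine ⟨Equiv.ofBijective _ ((Fintype.bijective_iff_injective_and_card _).2 ⟨hinj, hcard⟩),
    fun x => ?_, fun x => ?_⟩
  · change w' (p (a x)) = a' (w' (p x))
    rw [ha' _ (hcard ▸ hp x), ← hpw _ (hA _ (hp x)), ← ha _ (hp x), hwp]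
  · change w' (p (b x)) = b' (w' (p x))
    rw [hb' _ (hcard ▸ hp x), ← hpw _ (hB _ (hp x)), ← hb _ (hp x), hwp]

theorem fstIndex_lt {n k : ℕ} (hk : k < n) : fstIndex n k < n := by
  unfold fstIndex; split_ifs <;> omega

theorem sndIndexPath_lt {n k : ℕ} (hk : k < n) : sndIndexPath n k < n := by
  unfold sndIndexPath; split_ifs <;> omega

theorem sndIndexCycle_lt {n k : ℕ} (hk : k < n) : sndIndexCycle n k < n := by
  unfold sndIndexCycle; split_ifs <;> omega

section Classification

variable [Fintype M] [Fintype M'] (hcard : Fintype.card M = Fintype.card M')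
  {a b : Equiv.Perm M} {a' b' : Equiv.Perm M'}
  (ha : ∀ y, a (a y) = y) (hb : ∀ y, b (b y) = y)
  (ha' : ∀ y, a' (a' y) = y) (hb' : ∀ y, b' (b' y) = y)
  (htrans : ∀ x y : M, ∃ g ∈ Subgroup.closure ({a, b} : Set (Equiv.Perm M)), g x = y)
  (htrans' : ∀ x y : M', ∃ g ∈ Subgroup.closure ({a', b'} : Set (Equiv.Perm M')), g x = y)

include hcard ha hb ha' hb' htrans htrans'

theorem exists_equiv_of_fixed (hx : ∃ x, b x = x) (hx' : ∃ x, b' x = x) :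
    ∃ φ : M ≃ M', (∀ x, φ (a x) = a' (φ x)) ∧ ∀ x, φ (b x) = b' (φ x) := by
  obtain ⟨x, hx⟩ := hx
  obtain ⟨x', hx'⟩ := hx'
  have hinj := injOn_walk_path ha hb htrans hx
  have hinj' := injOn_walk_path ha' hb' htrans' hx'
  exact exists_equiv_of_enumeration hcard hinj (exists_walk_eq_of_injOn hinj) hinj'
    (fun _ => fstIndex_lt) (fun _ => sndIndexPath_lt)
    (fun _ => fst_walk ha hinj) (fun _ => snd_walk_path hb hinj hx)
    (fun _ hk => hcard ▸ fst_walk ha' hinj' hk) (fun _ hk => hcard ▸ snd_walk_path hb' hinj' hx' hk)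

theorem exists_equiv_of_no_fixed [Nonempty M] [Nonempty M']
    (hfa : ∀ y, a y ≠ y) (hfb : ∀ y, b y ≠ y) (hfa' : ∀ y, a' y ≠ y) (hfb' : ∀ y, b' y ≠ y) :
    ∃ φ : M ≃ M', (∀ x, φ (a x) = a' (φ x)) ∧ ∀ x, φ (b x) = b' (φ x) := by
  have hinj := injOn_walk_cycle (x := Classical.arbitrary M) ha hb htrans hfa hfb
  have hinj' := injOn_walk_cycle (x := Classical.arbitrary M') ha' hb' htrans' hfa' hfb'
  exact exists_equiv_of_enumeration hcard hinj (exists_walk_eq_of_injOn hinj) hinj'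
    (fun _ => fstIndex_lt) (fun _ => sndIndexCycle_lt)
    (fun _ => fst_walk ha hinj) (fun _ => snd_walk_cycle ha hb hinj hfa hfb)
    (fun _ hk => hcard ▸ fst_walk ha' hinj' hk)
    (fun _ hk => hcard ▸ snd_walk_cycle ha' hb' hinj' hfa' hfb' hk)

end Classification

theorem exists_fixed_iff_of_card_eq [Fintype M] [Fintype M'] [DecidableEq M] [DecidableEq M']
    {s : Equiv.Perm M} {s' : Equiv.Perm M'}
    (h : (Finset.univ.filter fun x : M => s x = x).card =
      (Finset.univ.filter fun x : M' => s' x = x).card) :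
    (∃ x, s x = x) ↔ ∃ x, s' x = x := by
  have := congrArg (0 < ·) h
  simpa [Finset.card_pos, Finset.filter_nonempty_iff] using this

theorem apply_apply_of_sq_eq_one {s : Equiv.Perm M} (h : s ^ 2 = 1) (x : M) : s (s x) = x := by
  rw [← Equiv.Perm.mul_apply, ← sq, h, Equiv.Perm.one_apply]

end InvolutionPair

/-- Transitive dihedral actions on finite sets are classified by the cardinality of
the set together with the fixed-point counts of the two generating involutions:
if `(s₁,s₂)` on `M` and `(s₁',s₂')` on `M'` are transitive pairs of involutions with
`|M| = |M'|` and matching fixed-point counts, then there is a bijection `φ : M → M'`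
with `φ ∘ s₁ = s₁' ∘ φ` and `φ ∘ s₂ = s₂' ∘ φ`. -/
theorem transitive_involution_pair_classification
    (M M' : Type*) [Fintype M] [Fintype M'] [Nonempty M] [Nonempty M']
    [DecidableEq M] [DecidableEq M']
    (s₁ s₂ : Equiv.Perm M) (h₁ : s₁ ^ 2 = 1) (h₂ : s₂ ^ 2 = 1)
    (s₁' s₂' : Equiv.Perm M') (h₁' : s₁' ^ 2 = 1) (h₂' : s₂' ^ 2 = 1)
    (htrans : ∀ x y : M,
      ∃ g ∈ Subgroup.closure ({s₁, s₂} : Set (Equiv.Perm M)), g x = y)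
    (htrans' : ∀ x y : M',
      ∃ g ∈ Subgroup.closure ({s₁', s₂'} : Set (Equiv.Perm M')), g x = y)
    (hcard : Fintype.card M = Fintype.card M')
    (hfix₁ : (Finset.univ.filter fun x : M => s₁ x = x).card =
      (Finset.univ.filter fun x : M' => s₁' x = x).card)
    (hfix₂ : (Finset.univ.filter fun x : M => s₂ x = x).card =
      (Finset.univ.filter fun x : M' => s₂' x = x).card) :
    ∃ φ : M ≃ M',
      (∀ x : M, φ (s₁ x) = s₁' (φ x)) ∧ (∀ x : M, φ (s₂ x) = s₂' (φ x)) := by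
  have e₁ := InvolutionPair.apply_apply_of_sq_eq_one h₁
  have e₂ := InvolutionPair.apply_apply_of_sq_eq_one h₂
  have e₁' := InvolutionPair.apply_apply_of_sq_eq_one h₁'
  have e₂' := InvolutionPair.apply_apply_of_sq_eq_one h₂'
  have f₁ := InvolutionPair.exists_fixed_iff_of_card_eq hfix₁
  have f₂ := InvolutionPair.exists_fixed_iff_of_card_eq hfix₂
  by_cases hx₂ : ∃ x, s₂ x = x
  · exact InvolutionPair.exists_equiv_of_fixed hcard e₁ e₂ e₁' e₂' htrans htrans' hx₂ (f₂.1 hx₂)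
  by_cases hx₁ : ∃ x, s₁ x = x
  · rw [Set.pair_comm] at htrans htrans'
    obtain ⟨φ, hφ₂, hφ₁⟩ := InvolutionPair.exists_equiv_of_fixed hcard e₂ e₁ e₂' e₁'
      htrans htrans' hx₁ (f₁.1 hx₁)
    exact ⟨φ, hφ₁, hφ₂⟩
  · exact InvolutionPair.exists_equiv_of_no_fixed hcard e₁ e₂ e₁' e₂' htrans htrans'
      (not_exists.1 hx₁) (not_exists.1 hx₂)
      (not_exists.1 (f₁.not.1 hx₁)) (not_exists.1 (f₂.not.1 hx₂))
end

section
/- Let M be a finite set and let (s₁, s₂) and (s₁', s₂') be two ordered pairs of involutive permutations of M. Then the pairs are simultaneously conjugate — i.e. there exists a permutation g of M with g s₁ g⁻¹ = s₁' and g s₂ g⁻¹ = s₂' — if and only if there exists a bijection Φ from the set of orbits of the subgroup ⟨s₁, s₂⟩ on M to the set of orbits of the subgroup ⟨s₁', s₂'⟩ on M such that for every orbit O: |Φ(O)| = |O|, the number of fixed points of s₁ in O equals the number of fixed points of s₁' in Φ(O), and the number of fixed points of s₂ in O equals the number of fixed points of s₂' in Φ(O). -/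
/-- The orbit of `x` under the subgroup generated by the two permutations
`s₁, s₂`, as a set. -/
def dihedralOrbit {M : Type*} (s₁ s₂ : Equiv.Perm M) (x : M) : Set M :=
  {y | ∃ g ∈ Subgroup.closure ({s₁, s₂} : Set (Equiv.Perm M)), g x = y}

/-- The set of orbits of the subgroup generated by `s₁, s₂`. -/
def dihedralOrbits {M : Type*} (s₁ s₂ : Equiv.Perm M) : Set (Set M) :=
  Set.range (dihedralOrbit s₁ s₂)

/-- The point reached from `x` by applying `s` if `p.2` holds, and then `(t * s) ^ p.1`. -/
def dihedralWalk {M : Type*} (s t : Equiv.Perm M) (x : M) (p : ℤ × Bool) : M :=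
  ((t * s) ^ p.1) (if p.2 then s x else x)

section

variable {M N : Type*} {s t : Equiv.Perm M} {s' t' : Equiv.Perm N} {x y : M} {x' : N}

theorem apply_apply_of_sq_eq_one (hs : s ^ 2 = 1) (x : M) : s (s x) = x := by
  rw [← Equiv.Perm.mul_apply, ← sq, hs, Equiv.Perm.one_apply]

theorem apply_zpow_mul_apply (hs : s ^ 2 = 1) (ht : t ^ 2 = 1) (k : ℤ) (x : M) :
    s (((t * s) ^ k) x) = ((t * s) ^ (-k)) (s x) := by
  have hs' : s⁻¹ = s := inv_eq_of_mul_eq_one_left (by rw [← sq, hs])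
  have ht' : t⁻¹ = t := inv_eq_of_mul_eq_one_left (by rw [← sq, ht])
  have h : SemiconjBy s (t * s) (t * s)⁻¹ := by
    rw [SemiconjBy, mul_inv_rev, hs', ht', mul_assoc]
  have := h.zpow_right k
  rw [inv_zpow'] at this
  exact congrArg (fun g : Equiv.Perm M => g x) this.eq

theorem apply_dihedralWalk_left (hs : s ^ 2 = 1) (ht : t ^ 2 = 1) (x : M) (p : ℤ × Bool) :
    s (dihedralWalk s t x p) = dihedralWalk s t x (-p.1, !p.2) := by
  rcases p with ⟨k, b⟩
  cases b <;> simp [dihedralWalk, apply_zpow_mul_apply hs ht, apply_apply_of_sq_eq_one hs]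

theorem apply_dihedralWalk_right (hs : s ^ 2 = 1) (ht : t ^ 2 = 1) (x : M) (p : ℤ × Bool) :
    t (dihedralWalk s t x p) = dihedralWalk s t x (1 - p.1, !p.2) := by
  have h : t (dihedralWalk s t x p) = (t * s) (s (dihedralWalk s t x p)) := by
    rw [Equiv.Perm.mul_apply, apply_apply_of_sq_eq_one hs]
  rw [h, apply_dihedralWalk_left hs ht, dihedralWalk, dihedralWalk, sub_eq_add_neg, zpow_one_add,
    Equiv.Perm.mul_apply _ (_ ^ _)]

theorem dihedralOrbit_eq_range (hs : s ^ 2 = 1) (ht : t ^ 2 = 1) (x : M) :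
    dihedralOrbit s t x = Set.range (dihedralWalk s t x) := by
  have hs' : s ∈ Subgroup.closure ({s, t} : Set (Equiv.Perm M)) :=
    Subgroup.subset_closure (by simp)
  have ht' : t ∈ Subgroup.closure ({s, t} : Set (Equiv.Perm M)) :=
    Subgroup.subset_closure (by simp)
  apply Set.Subset.antisymm
  · rintro _ ⟨g, hg, rfl⟩
    have key : ∀ y, y ∈ Set.range (dihedralWalk s t x) ↔
        g y ∈ Set.range (dihedralWalk s t x) := by
      induction hg using Subgroup.closure_induction with
      | mem g hg =>
        have h : g ^ 2 = 1 ∧ ∀ y ∈ Set.range (dihedralWalk s t x),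
            g y ∈ Set.range (dihedralWalk s t x) := by
          rcases hg with rfl | rfl
          · refine ⟨hs, ?_⟩
            rintro _ ⟨p, rfl⟩
            exact ⟨_, (apply_dihedralWalk_left hs ht x p).symm⟩
          · refine ⟨ht, ?_⟩
            rintro _ ⟨p, rfl⟩
            exact ⟨_, (apply_dihedralWalk_right hs ht x p).symm⟩
        intro y
        refine ⟨h.2 y, fun hy => ?_⟩
        simpa [apply_apply_of_sq_eq_one h.1] using h.2 _ hy
      | one => simp
      | mul g h _ _ hg hh => exact fun y => (hh y).trans (hg (h y))
      | inv g _ hg => exact fun y => by simpa using (hg (g⁻¹ y)).symm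
    exact (key x).1 ⟨(0, false), by simp [dihedralWalk]⟩
  · rintro _ ⟨⟨k, b⟩, rfl⟩
    have hk := zpow_mem (mul_mem ht' hs') k
    cases b
    · exact ⟨_, hk, rfl⟩
    · exact ⟨_, mul_mem hk hs', rfl⟩

theorem mem_dihedralOrbit_self (s t : Equiv.Perm M) (x : M) : x ∈ dihedralOrbit s t x :=
  ⟨1, one_mem _, rfl⟩

theorem dihedralOrbit_eq_of_mem (h : y ∈ dihedralOrbit s t x) :
    dihedralOrbit s t y = dihedralOrbit s t x := by
  obtain ⟨g, hg, rfl⟩ := h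
  ext z
  constructor
  · rintro ⟨k, hk, rfl⟩
    exact ⟨k * g, mul_mem hk hg, rfl⟩
  · rintro ⟨k, hk, rfl⟩
    exact ⟨k * g⁻¹, mul_mem hk (inv_mem hg), by simp⟩

theorem eq_dihedralOrbit_of_mem {O : Set M} (hO : O ∈ dihedralOrbits s t) (h : x ∈ O) :
    O = dihedralOrbit s t x := by
  obtain ⟨y, rfl⟩ := hO
  exact (dihedralOrbit_eq_of_mem h).symm

theorem dihedralOrbit_comm (s t : Equiv.Perm M) : dihedralOrbit s t = dihedralOrbit t s := by
  unfold dihedralOrbit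
  rw [Set.pair_comm]

theorem apply_left_mem_dihedralOrbit (s t : Equiv.Perm M) (x : M) :
    s x ∈ dihedralOrbit s t x :=
  ⟨s, Subgroup.subset_closure (by simp), rfl⟩

theorem apply_right_mem_dihedralOrbit (s t : Equiv.Perm M) (x : M) :
    t x ∈ dihedralOrbit s t x :=
  ⟨t, Subgroup.subset_closure (by simp), rfl⟩

theorem zpow_apply_eq_iff_ncard_range_dvd (r : Equiv.Perm M) (x : M) (k l : ℤ) :
    (r ^ k) x = (r ^ l) x ↔ ((Set.range fun j : ℤ => (r ^ j) x).ncard : ℤ) ∣ k - l := by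
  have h : (Set.range fun j : ℤ => (r ^ j) x) = MulAction.orbit (Subgroup.zpowers r) x := by
    ext y
    constructor
    · rintro ⟨j, rfl⟩
      exact ⟨⟨r ^ j, j, rfl⟩, rfl⟩
    · rintro ⟨⟨_, j, rfl⟩, rfl⟩
      exact ⟨j, rfl⟩
  have hcard : (Set.range fun j : ℤ => (r ^ j) x).ncard =
      Function.minimalPeriod (r • ·) x := by
    rw [h, ← Nat.card_coe_set_eq, Nat.card_congr (MulAction.orbitZPowersEquiv r x),
      Nat.card_zmod]
  rw [hcard, ← MulAction.zpow_smul_eq_iff_minimalPeriod_dvd, Equiv.Perm.smul_def, sub_eq_neg_add,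
    zpow_add, Equiv.Perm.mul_apply, zpow_neg, Equiv.Perm.inv_eq_iff_eq, eq_comm]

theorem dihedralWalk_eq_iff_of_fixed (hs : s ^ 2 = 1) (ht : t ^ 2 = 1) (hx : s x = x)
    (p q : ℤ × Bool) :
    dihedralWalk s t x p = dihedralWalk s t x q ↔
      ((dihedralOrbit s t x).ncard : ℤ) ∣ p.1 - q.1 := by
  have hwalk : dihedralWalk s t x = fun p => ((t * s) ^ p.1) x := by
    ext p
    simp [dihedralWalk, hx]
  have hrange : dihedralOrbit s t x = Set.range fun j : ℤ => ((t * s) ^ j) x := by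
    rw [dihedralOrbit_eq_range hs ht, hwalk]
    exact Prod.fst_surjective.range_comp (fun j : ℤ => ((t * s) ^ j) x)
  rw [hrange, hwalk, zpow_apply_eq_iff_ncard_range_dvd]

theorem dihedralWalk_false_ne_true (hs : s ^ 2 = 1) (ht : t ^ 2 = 1)
    (hfs : ∀ y ∈ dihedralOrbit s t x, s y ≠ y) (hft : ∀ y ∈ dihedralOrbit s t x, t y ≠ y)
    (k l : ℤ) : dihedralWalk s t x (k, false) ≠ dihedralWalk s t x (l, true) := by
  rw [dihedralOrbit_eq_range hs ht] at hfs hft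
  intro h
  have shift : ∀ j : ℤ,
      dihedralWalk s t x (k + j, false) = dihedralWalk s t x (l + j, true) := fun j => by
    have := congrArg ((t * s) ^ j) h
    simpa [dihedralWalk, add_comm _ j, zpow_add] using this
  rcases Int.even_or_odd' (k - l) with ⟨m, hm | hm⟩
  · refine hfs _ ⟨(m, false), rfl⟩ ?_
    rw [apply_dihedralWalk_left hs ht]
    convert (shift (m - k)).symm using 3 <;> grind
  · refine hft _ ⟨(m + 1, false), rfl⟩ ?_
    rw [apply_dihedralWalk_right hs ht]
    convert (shift (m + 1 - k)).symm using 3 <;> grind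

theorem dihedralWalk_eq_iff_of_forall_ne [Finite M] (hs : s ^ 2 = 1) (ht : t ^ 2 = 1)
    (hfs : ∀ y ∈ dihedralOrbit s t x, s y ≠ y) (hft : ∀ y ∈ dihedralOrbit s t x, t y ≠ y)
    (p q : ℤ × Bool) :
    dihedralWalk s t x p = dihedralWalk s t x q ↔
      p.2 = q.2 ∧ ((dihedralOrbit s t x).ncard : ℤ) ∣ 2 * (p.1 - q.1) := by
  have hne := dihedralWalk_false_ne_true hs ht hfs hft
  have htrue (j : ℤ) : dihedralWalk s t x (j, true) = s (((t * s) ^ (-j)) x) := by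
    rw [apply_zpow_mul_apply hs ht, neg_neg]
    rfl
  set A := Set.range fun j : ℤ => ((t * s) ^ j) x with hA
  have hunion : dihedralOrbit s t x = A ∪ s '' A := by
    rw [dihedralOrbit_eq_range hs ht]
    ext y
    constructor
    · rintro ⟨⟨k, b⟩, rfl⟩
      cases b
      · exact Or.inl ⟨k, rfl⟩
      · exact Or.inr ⟨_, ⟨-k, rfl⟩, (htrue k).symm⟩
    · rintro (⟨k, rfl⟩ | ⟨_, ⟨k, rfl⟩, rfl⟩)
      · exact ⟨(k, false), rfl⟩
      · exact ⟨(-k, true), by simp [dihedralWalk, apply_zpow_mul_apply hs ht]⟩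
  have hdisj : Disjoint A (s '' A) := by
    rw [Set.disjoint_left]
    rintro _ ⟨k, rfl⟩ ⟨_, ⟨l, rfl⟩, h⟩
    refine hne k (-l) ?_
    simpa [dihedralWalk, apply_zpow_mul_apply hs ht] using h.symm
  have hcard : (dihedralOrbit s t x).ncard = 2 * A.ncard := by
    rw [hunion, Set.ncard_union_eq hdisj, Set.ncard_image_of_injective _ s.injective, two_mul]
  rw [hcard, Nat.cast_mul, Nat.cast_ofNat, mul_dvd_mul_iff_left two_ne_zero]
  rcases p with ⟨k, b⟩
  rcases q with ⟨l, c⟩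
  cases b <;> cases c
  · simp [dihedralWalk, zpow_apply_eq_iff_ncard_range_dvd, hA]
  · simpa using hne k l
  · simpa using (hne l k).symm
  · rw [htrue, htrue, s.injective.eq_iff, zpow_apply_eq_iff_ncard_range_dvd, ← hA]
    simp only [true_and]
    rw [← dvd_neg]
    ring_nf

theorem exists_bijOn_of_dihedralWalk_eq_iff [Nonempty N] (hs : s ^ 2 = 1) (ht : t ^ 2 = 1)
    (hs' : s' ^ 2 = 1) (ht' : t' ^ 2 = 1)
    (h : ∀ p q, dihedralWalk s t x p = dihedralWalk s t x q ↔
      dihedralWalk s' t' x' p = dihedralWalk s' t' x' q) :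
    ∃ f : M → N, Set.BijOn f (dihedralOrbit s t x) (dihedralOrbit s' t' x') ∧
      ∀ y ∈ dihedralOrbit s t x, f (s y) = s' (f y) ∧ f (t y) = t' (f y) := by
  obtain ⟨f, hf⟩ : ∃ f : M → N, ∀ p, f (dihedralWalk s t x p) = dihedralWalk s' t' x' p :=
    ⟨Function.extend (dihedralWalk s t x) (dihedralWalk s' t' x') fun _ => Classical.arbitrary N,
      Function.FactorsThrough.extend_apply (fun p q => (h p q).1) _⟩
  rw [dihedralOrbit_eq_range hs ht, dihedralOrbit_eq_range hs' ht']
  refine ⟨f, ⟨?_, ?_, ?_⟩, ?_⟩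
  · rintro _ ⟨p, rfl⟩
    exact ⟨p, (hf p).symm⟩
  · rintro _ ⟨p, rfl⟩ _ ⟨q, rfl⟩ hpq
    rwa [hf, hf, ← h] at hpq
  · rintro _ ⟨p, rfl⟩
    exact ⟨_, ⟨p, rfl⟩, hf p⟩
  · rintro _ ⟨p, rfl⟩
    rw [apply_dihedralWalk_left hs ht, apply_dihedralWalk_right hs ht, hf, hf, hf,
      apply_dihedralWalk_left hs' ht', apply_dihedralWalk_right hs' ht']
    exact ⟨rfl, rfl⟩

theorem exists_bijOn_of_fixed (hs : s ^ 2 = 1) (ht : t ^ 2 = 1)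
    (hs' : s' ^ 2 = 1) (ht' : t' ^ 2 = 1) (hx : s x = x) (hx' : s' x' = x')
    (hcard : (dihedralOrbit s' t' x').ncard = (dihedralOrbit s t x).ncard) :
    ∃ f : M → N, Set.BijOn f (dihedralOrbit s t x) (dihedralOrbit s' t' x') ∧
      ∀ y ∈ dihedralOrbit s t x, f (s y) = s' (f y) ∧ f (t y) = t' (f y) := by
  have : Nonempty N := ⟨x'⟩
  refine exists_bijOn_of_dihedralWalk_eq_iff hs ht hs' ht' fun p q => ?_
  rw [dihedralWalk_eq_iff_of_fixed hs ht hx, dihedralWalk_eq_iff_of_fixed hs' ht' hx', hcard]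

/-- Two orbits with the same size and the same numbers of fixed points are equivariantly
isomorphic. -/
theorem exists_bijOn_of_ncard_eq [Finite M] [Finite N] (hs : s ^ 2 = 1) (ht : t ^ 2 = 1)
    (hs' : s' ^ 2 = 1) (ht' : t' ^ 2 = 1) {O : Set M} {O' : Set N}
    (hO : O ∈ dihedralOrbits s t) (hO' : O' ∈ dihedralOrbits s' t') (hcard : O'.ncard = O.ncard)
    (hfix : {x ∈ O' | s' x = x}.ncard = {x ∈ O | s x = x}.ncard)
    (hfix' : {x ∈ O' | t' x = x}.ncard = {x ∈ O | t x = x}.ncard) :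
    ∃ f : M → N, Set.BijOn f O O' ∧ ∀ y ∈ O, f (s y) = s' (f y) ∧ f (t y) = t' (f y) := by
  have nonempty_iff {u : Equiv.Perm M} {u' : Equiv.Perm N}
      (h : {x ∈ O' | u' x = x}.ncard = {x ∈ O | u x = x}.ncard) :
      {x ∈ O' | u' x = x}.Nonempty ↔ {x ∈ O | u x = x}.Nonempty := by
    rw [← Set.ncard_pos, ← Set.ncard_pos, h]
  by_cases h : {x ∈ O | s x = x}.Nonempty
  · obtain ⟨x', hx', hfx'⟩ := (nonempty_iff hfix).2 h
    obtain ⟨x, hx, hfx⟩ := h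
    obtain rfl := eq_dihedralOrbit_of_mem hO hx
    obtain rfl := eq_dihedralOrbit_of_mem hO' hx'
    exact exists_bijOn_of_fixed hs ht hs' ht' hfx hfx' hcard
  by_cases h' : {x ∈ O | t x = x}.Nonempty
  · obtain ⟨x', hx', hfx'⟩ := (nonempty_iff hfix').2 h'
    obtain ⟨x, hx, hfx⟩ := h'
    obtain rfl := eq_dihedralOrbit_of_mem hO hx
    obtain rfl := eq_dihedralOrbit_of_mem hO' hx'
    rw [dihedralOrbit_comm s, dihedralOrbit_comm s'] at hcard ⊢
    obtain ⟨f, hf, hfst⟩ := exists_bijOn_of_fixed ht hs ht' hs' hfx hfx' hcard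
    exact ⟨f, hf, fun y hy => (hfst y hy).symm⟩
  have h₂ := mt (nonempty_iff hfix).1 h
  have h₂' := mt (nonempty_iff hfix').1 h'
  obtain ⟨x, rfl⟩ := hO
  obtain ⟨x', rfl⟩ := hO'
  have : Nonempty N := ⟨x'⟩
  refine exists_bijOn_of_dihedralWalk_eq_iff hs ht hs' ht' fun p q => ?_
  rw [dihedralWalk_eq_iff_of_forall_ne hs ht (fun y hy e => h ⟨y, hy, e⟩)
      fun y hy e => h' ⟨y, hy, e⟩,
    dihedralWalk_eq_iff_of_forall_ne hs' ht' (fun y hy e => h₂ ⟨y, hy, e⟩)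
      fun y hy e => h₂' ⟨y, hy, e⟩, hcard]

theorem image_dihedralOrbit_of_semiconj (hs : s ^ 2 = 1) (ht : t ^ 2 = 1)
    (hs' : s' ^ 2 = 1) (ht' : t' ^ 2 = 1) {f : M → N} (hfs : Function.Semiconj f s s')
    (hft : Function.Semiconj f t t') (x : M) :
    f '' dihedralOrbit s t x = dihedralOrbit s' t' (f x) := by
  have hr : Function.Semiconj f (t * s : Equiv.Perm M) (t' * s' : Equiv.Perm N) :=
    hft.comp_right hfs
  have hr' : Function.Semiconj f ((t * s)⁻¹ : Equiv.Perm M) ((t' * s')⁻¹ : Equiv.Perm N) :=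
    hr.inverses_right (Equiv.right_inv _) (Equiv.left_inv _)
  have hpow (k : ℤ) (y : M) : f (((t * s) ^ k) y) = ((t' * s') ^ k) (f y) := by
    induction k generalizing y with
    | zero => rfl
    | succ k ih => rw [zpow_add_one, zpow_add_one, Equiv.Perm.mul_apply, ih, hr.eq]; rfl
    | pred k ih => rw [zpow_sub_one, zpow_sub_one, Equiv.Perm.mul_apply, ih, hr'.eq]; rfl
  rw [dihedralOrbit_eq_range hs ht, dihedralOrbit_eq_range hs' ht', ← Set.range_comp]
  congr 1
  ext ⟨k, b⟩
  cases b <;> simp [dihedralWalk, hpow, hfs.eq]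

end


/-- Two ordered pairs of involutive permutations of a finite set `M` are
simultaneously conjugate iff there is a bijection between the orbit sets of the
generated subgroups matching orbit sizes and the fixed-point counts of the two
involutions on each orbit (i.e. iff the dihedral decompositions coincide). -/
theorem involution_pairs_conj_iff_dihedral_decomposition
    (M : Type*) [Fintype M]
    (s₁ s₂ s₁' s₂' : Equiv.Perm M)
    (h₁ : s₁ ^ 2 = 1) (h₂ : s₂ ^ 2 = 1) (h₁' : s₁' ^ 2 = 1) (h₂' : s₂' ^ 2 = 1) :
    (∃ g : Equiv.Perm M, g * s₁ * g⁻¹ = s₁' ∧ g * s₂ * g⁻¹ = s₂') ↔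
      ∃ Φ : ↥(dihedralOrbits s₁ s₂) ≃ ↥(dihedralOrbits s₁' s₂'),
        ∀ O : ↥(dihedralOrbits s₁ s₂),
          (Φ O : Set M).ncard = (O : Set M).ncard ∧
          {x ∈ (Φ O : Set M) | s₁' x = x}.ncard =
            {x ∈ (O : Set M) | s₁ x = x}.ncard ∧
          {x ∈ (Φ O : Set M) | s₂' x = x}.ncard =
            {x ∈ (O : Set M) | s₂ x = x}.ncard := by
  constructor
  · rintro ⟨g, hg₁, hg₂⟩
    have semiconj {u u' : Equiv.Perm M} (h : g * u * g⁻¹ = u') : Function.Semiconj g u u' :=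
      fun x => by simp [← h]
    have himage := image_dihedralOrbit_of_semiconj h₁ h₂ h₁' h₂' (semiconj hg₁) (semiconj hg₂)
    have hmem (O : Set M) :
        O ∈ dihedralOrbits s₁ s₂ ↔ Equiv.Set.congr g O ∈ dihedralOrbits s₁' s₂' := by
      constructor
      · rintro ⟨x, rfl⟩
        exact ⟨g x, (himage x).symm⟩
      · rintro ⟨x, hx⟩
        refine ⟨g.symm x, g.injective.image_injective ?_⟩
        rw [himage, g.apply_symm_apply, hx]
        rfl
    have hfix {u u' : Equiv.Perm M} (h : g * u * g⁻¹ = u') (O : Set M) :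
        {x ∈ g '' O | u' x = x}.ncard = {x ∈ O | u x = x}.ncard := by
      rw [← Set.ncard_image_of_injective {x ∈ O | u x = x} g.injective]
      congr 1
      ext y
      constructor
      · rintro ⟨⟨x, hx, rfl⟩, hy⟩
        rw [← (semiconj h).eq] at hy
        exact ⟨x, ⟨hx, g.injective hy⟩, rfl⟩
      · rintro ⟨x, ⟨hx, hfx⟩, rfl⟩
        exact ⟨⟨x, hx, rfl⟩, by rw [← (semiconj h).eq, hfx]⟩
    exact ⟨(Equiv.Set.congr g).subtypeEquiv hmem, fun O =>
      ⟨Set.ncard_image_of_injective _ g.injective, hfix hg₁ O, hfix hg₂ O⟩⟩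
  · rintro ⟨Φ, hΦ⟩
    choose f hf hfs using fun O => exists_bijOn_of_ncard_eq h₁ h₂ h₁' h₂' O.2 (Φ O).2
      (hΦ O).1 (hΦ O).2.1 (hΦ O).2.2
    let orb (x : M) : dihedralOrbits s₁ s₂ := ⟨dihedralOrbit s₁ s₂ x, x, rfl⟩
    have hself (x : M) : x ∈ (orb x : Set M) := mem_dihedralOrbit_self s₁ s₂ x
    have horb₁ (x : M) : orb (s₁ x) = orb x :=
      Subtype.ext (dihedralOrbit_eq_of_mem (apply_left_mem_dihedralOrbit s₁ s₂ x))
    have horb₂ (x : M) : orb (s₂ x) = orb x :=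
      Subtype.ext (dihedralOrbit_eq_of_mem (apply_right_mem_dihedralOrbit s₁ s₂ x))
    have hinj : Function.Injective fun x => f (orb x) x := by
      intro x y (hxy : f (orb x) x = f (orb y) y)
      have hx := (hf (orb x)).mapsTo (hself x)
      have hy := (hf (orb y)).mapsTo (hself y)
      rw [← hxy] at hy
      have horb : orb x = orb y := Φ.injective <| Subtype.ext <|
        (eq_dihedralOrbit_of_mem (Φ _).2 hx).trans (eq_dihedralOrbit_of_mem (Φ _).2 hy).symm
      rw [← horb] at hxy
      exact (hf (orb x)).injOn (hself x) (horb ▸ hself y) hxy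
    let g : Equiv.Perm M := Equiv.ofBijective _ (Finite.injective_iff_bijective.1 hinj)
    have hg (x : M) : g x = f (orb x) x := rfl
    refine ⟨g, ?_, ?_⟩ <;> rw [mul_inv_eq_iff_eq_mul] <;> ext x <;>
      rw [Equiv.Perm.mul_apply, Equiv.Perm.mul_apply, hg, hg]
    · rw [horb₁, (hfs (orb x) x (hself x)).1]
    · rw [horb₂, (hfs (orb x) x (hself x)).2]
end
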